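/- Let G be a non-elementary word-hyperbolic group with a finite generating set X. Then there exist real constants λ > 1 and C, D > 0 such that for all integers n ≥ 1, C·λⁿ ≤ 𝔖(n) ≤ D·λⁿ, where 𝔖(n) is the cardinality of the sphere of radius n in G with respect to X. Equivalently, the polynomial exponent α produced by the rational-growth asymptotics of the sphere sizes of G with respect to X equals 0. -/

import Mathlib

/-!
Coornaert's theorem: a non-elementary word-hyperbolic group has purely
exponential growth of balls.
-/

/-- The word length of `g` with respect to a generating set `X`: the least `n` such that
`g` is a product of `n` elements of `X ∪ X⁻¹`. -/
noncomputable def wordLength {G : Type*} [Group G] (X : Set G) (g : G) : ℕ :=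
  sInf {n | ∃ w : List G, w.length = n ∧ (∀ x ∈ w, x ∈ X ∨ x⁻¹ ∈ X) ∧ w.prod = g}

/-- The word metric `d(g,h) = |g⁻¹h|_X`. -/
noncomputable def wordDist {G : Type*} [Group G] (X : Set G) (g h : G) : ℕ :=
  wordLength X (g⁻¹ * h)

/-- `𝔖(n)`, the cardinality of the sphere of radius `n`. -/
noncomputable def sphereCard {G : Type*} [Group G] (X : Set G) (n : ℕ) : ℕ :=
  {g : G | wordLength X g = n}.ncard

/-- `𝔅(n)`, the cardinality of the ball of radius `n`. -/
noncomputable def ballCard {G : Type*} [Group G] (X : Set G) (n : ℕ) : ℕ :=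
  {g : G | wordLength X g ≤ n}.ncard

/-- A (discrete) geodesic in the Cayley graph `Γ(G,X)` from `a` to `b`: the sequence of
vertices visited by a geodesic path, parametrised by arc length. -/
def IsGeodesic {G : Type*} [Group G] (X : Set G) (a b : G) (γ : ℕ → G) : Prop :=
  γ 0 = a ∧ γ (wordDist X a b) = b ∧
    ∀ i j, i ≤ wordDist X a b → j ≤ wordDist X a b →
      wordDist X (γ i) (γ j) = Nat.dist i j

/-- Triangles in the Cayley graph `Γ(G,X)` are `δ`-thin (`δ` a positive integer): every
vertex on one side of a geodesic triangle is at distance at most `δ` from the union of the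
other two sides. -/
def TrianglesThin {G : Type*} [Group G] (X : Set G) (δ : ℕ) : Prop :=
  ∀ (a b c : G) (γ₁ γ₂ γ₃ : ℕ → G),
    IsGeodesic X a b γ₁ → IsGeodesic X b c γ₂ → IsGeodesic X a c γ₃ →
    ∀ i ≤ wordDist X a c, ∃ j,
      (j ≤ wordDist X a b ∧ wordDist X (γ₃ i) (γ₁ j) ≤ δ) ∨
      (j ≤ wordDist X b c ∧ wordDist X (γ₃ i) (γ₂ j) ≤ δ)

/-- A group is virtually cyclic if it has a cyclic subgroup of finite index. -/
def VirtuallyCyclic (G : Type*) [Group G] : Prop :=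
  ∃ H : Subgroup G, IsCyclic H ∧ H.FiniteIndex

section WordLength

variable {G : Type*} [Group G] {X : Set G}

theorem exists_word (hgen : Subgroup.closure X = ⊤) (g : G) :
    ∃ w : List G, w.length = wordLength X g ∧ (∀ x ∈ w, x ∈ X ∨ x⁻¹ ∈ X) ∧ w.prod = g := by
  have hg : g ∈ Subgroup.closure X := hgen ▸ Subgroup.mem_top g
  rw [← Subgroup.mem_toSubmonoid, Subgroup.closure_toSubmonoid] at hg
  obtain ⟨w, hw, hwg⟩ := Submonoid.exists_list_of_mem_closure hg
  exact Nat.sInf_mem (s := {n | ∃ w : List G, w.length = n ∧ (∀ x ∈ w, x ∈ X ∨ x⁻¹ ∈ X) ∧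
    w.prod = g}) ⟨w.length, w, rfl, hw, hwg⟩

theorem wordLength_prod_le {w : List G} (hw : ∀ x ∈ w, x ∈ X ∨ x⁻¹ ∈ X) :
    wordLength X w.prod ≤ w.length :=
  Nat.sInf_le ⟨w, rfl, hw, rfl⟩

theorem wordLength_one : wordLength X (1 : G) = 0 := by
  simpa using wordLength_prod_le (X := X) (w := []) (by simp)

theorem wordLength_mul_le (hgen : Subgroup.closure X = ⊤) (g h : G) :
    wordLength X (g * h) ≤ wordLength X g + wordLength X h := by
  obtain ⟨v, hv, hvX, rfl⟩ := exists_word hgen g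
  obtain ⟨w, hw, hwX, rfl⟩ := exists_word hgen h
  rw [← hv, ← hw, ← List.prod_append, ← List.length_append]
  refine wordLength_prod_le fun x hx => ?_
  exact (List.mem_append.1 hx).elim (hvX x) (hwX x)

theorem wordLength_inv_le (hgen : Subgroup.closure X = ⊤) (g : G) :
    wordLength X g⁻¹ ≤ wordLength X g := by
  obtain ⟨w, hw, hwX, rfl⟩ := exists_word hgen g
  rw [← hw, List.prod_inv_reverse]
  refine (wordLength_prod_le fun x hx => ?_).trans_eq (by simp)
  simp only [List.mem_reverse, List.mem_map] at hx
  obtain ⟨y, hy, rfl⟩ := hx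
  rw [inv_inv]
  exact (hwX y hy).symm

theorem wordLength_inv (hgen : Subgroup.closure X = ⊤) (g : G) :
    wordLength X g⁻¹ = wordLength X g :=
  (wordLength_inv_le hgen g).antisymm (by simpa using wordLength_inv_le hgen g⁻¹)

theorem wordDist_comm (hgen : Subgroup.closure X = ⊤) (x y : G) :
    wordDist X x y = wordDist X y x := by
  rw [wordDist, ← wordLength_inv hgen, wordDist, mul_inv_rev, inv_inv]

theorem wordDist_triangle (hgen : Subgroup.closure X = ⊤) (x y z : G) :
    wordDist X x z ≤ wordDist X x y + wordDist X y z := by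
  simpa [wordDist, mul_assoc] using wordLength_mul_le hgen (x⁻¹ * y) (y⁻¹ * z)

theorem exists_isGeodesic (hgen : Subgroup.closure X = ⊤) (a b : G) :
    ∃ γ, IsGeodesic X a b γ := by
  obtain ⟨w, hw, hwX, hwb⟩ := exists_word hgen (a⁻¹ * b)
  have hle : ∀ i j, i ≤ j → j ≤ w.length →
      wordDist X (a * (w.take i).prod) (a * (w.take j).prod) ≤ j - i := by
    intro i j hij hj
    have hsplit := List.take_append_drop i (w.take j)
    rw [List.take_take, min_eq_left hij] at hsplit
    have hprod : (a * (w.take i).prod)⁻¹ * (a * (w.take j).prod) =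
        ((w.take j).drop i).prod := by
      have := congrArg List.prod hsplit
      rw [List.prod_append] at this
      rw [← this]
      simp [mul_assoc]
    rw [wordDist, hprod]
    refine (wordLength_prod_le fun x hx => hwX x ?_).trans (by simp; omega)
    exact List.mem_of_mem_take (List.mem_of_mem_drop hx)
  have hdist : ∀ i j, i ≤ j → j ≤ w.length →
      wordDist X (a * (w.take i).prod) (a * (w.take j).prod) = j - i := by
    intro i j hij hj
    have h1 := hle i j hij hj
    have h2 := hle 0 i (Nat.zero_le _) (hij.trans hj)
    have h3 := hle j w.length hj le_rfl
    have h4 := wordDist_triangle hgen a (a * (w.take i).prod) b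
    have h5 := wordDist_triangle hgen (a * (w.take i).prod) (a * (w.take j).prod) b
    rw [List.take_zero, List.prod_nil, mul_one] at h2
    rw [List.take_length, hwb, mul_inv_cancel_left] at h3
    have h6 : wordDist X a b = w.length := hw.symm
    omega
  refine ⟨fun i => a * (w.take i).prod, by simp, ?_, fun i j hi hj => ?_⟩
  · simp only [wordDist, ← hw, List.take_length, hwb, mul_inv_cancel_left]
  · rw [wordDist, ← hw] at hi hj
    rcases le_total i j with hij | hij
    · rw [hdist i j hij hj, Nat.dist_eq_sub_of_le hij]
    · rw [wordDist_comm hgen, hdist j i hij hi, Nat.dist_eq_sub_of_le_right hij]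

theorem IsGeodesic.wordDist_left {a b : G} {γ : ℕ → G} (hγ : IsGeodesic X a b γ) {i : ℕ}
    (hi : i ≤ wordDist X a b) : wordDist X a (γ i) = i := by
  have := hγ.2.2 0 i (Nat.zero_le _) hi
  rwa [hγ.1, Nat.dist_eq_sub_of_le (Nat.zero_le _), Nat.sub_zero] at this

theorem IsGeodesic.wordDist_right {a b : G} {γ : ℕ → G} (hγ : IsGeodesic X a b γ) {i : ℕ}
    (hi : i ≤ wordDist X a b) : wordDist X (γ i) b = wordDist X a b - i := by
  have := hγ.2.2 i _ hi le_rfl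
  rwa [hγ.2.1, Nat.dist_eq_sub_of_le hi] at this

/-- A geodesic from `x` to `y` passes close to `w`, measured by the Gromov product. -/
theorem TrianglesThin.exists_near {δ : ℕ} (hthin : TrianglesThin X δ)
    (hgen : Subgroup.closure X = ⊤) {x y : G} (w : G) {γ : ℕ → G} (hγ : IsGeodesic X x y γ) :
    ∃ i ≤ wordDist X x y,
      2 * wordDist X w (γ i) + wordDist X x y ≤
        wordDist X w x + wordDist X w y + (4 * δ + 2) := by
  obtain ⟨γ₁, h₁⟩ := exists_isGeodesic hgen x w
  obtain ⟨γ₂, h₂⟩ := exists_isGeodesic hgen w y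
  let P : ℕ → Prop := fun i => wordDist X w (γ i) + i ≤ wordDist X w x + 2 * δ
  let R : ℕ → Prop := fun i =>
    wordDist X w (γ i) + (wordDist X x y - i) ≤ wordDist X w y + 2 * δ
  have hPR : ∀ i ≤ wordDist X x y, P i ∨ R i := by
    intro i hi
    have l := hγ.wordDist_left hi
    have r := hγ.wordDist_right hi
    obtain ⟨j, ⟨hj, hd⟩ | ⟨hj, hd⟩⟩ := hthin x w y γ₁ γ₂ γ h₁ h₂ hγ i hi
    · left
      have l' := h₁.wordDist_left hj
      have r' := h₁.wordDist_right hj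
      have t1 := wordDist_triangle hgen w (γ₁ j) (γ i)
      have t2 := wordDist_triangle hgen x (γ₁ j) (γ i)
      rw [wordDist_comm hgen w (γ₁ j), wordDist_comm hgen (γ₁ j) (γ i)] at t1
      rw [wordDist_comm hgen (γ₁ j) (γ i)] at t2
      have := wordDist_comm hgen x w
      change _ ≤ _
      omega
    · right
      have l' := h₂.wordDist_left hj
      have r' := h₂.wordDist_right hj
      have t1 := wordDist_triangle hgen w (γ₂ j) (γ i)
      have t2 := wordDist_triangle hgen (γ i) (γ₂ j) y
      rw [wordDist_comm hgen (γ₂ j) (γ i)] at t1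
      change _ ≤ _
      omega
  by_cases hall : ∀ i ≤ wordDist X x y, P i
  · refine ⟨_, le_rfl, ?_⟩
    have := hall _ le_rfl
    simp only [P, hγ.2.1] at this ⊢
    omega
  push Not at hall
  classical
  obtain ⟨hk, hPk⟩ := Nat.find_spec hall
  have hmin := fun i => Nat.find_min hall (m := i)
  set k := Nat.find hall
  have hRk := (hPR k hk).resolve_left hPk
  cases hk' : k with
  | zero =>
    rw [hk'] at hPk
    simp only [P, hγ.1] at hPk
    omega
  | succ i =>
    rw [hk'] at hRk hk
    have hPi : P i := by
      by_contra hcon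
      exact hmin i (by omega) ⟨by omega, hcon⟩
    refine ⟨i, by omega, ?_⟩
    have t := wordDist_triangle hgen w (γ (i + 1)) (γ i)
    rw [hγ.2.2 (i + 1) i hk (by omega), Nat.dist_eq_sub_of_le_right (by omega)] at t
    simp only [P, R] at hPi hRk
    omega

theorem TrianglesThin.four_point {δ : ℕ} (hthin : TrianglesThin X δ)
    (hgen : Subgroup.closure X = ⊤) (x y z w : G) :
    wordDist X x y + wordDist X z w ≤ wordDist X x z + wordDist X y w + (6 * δ + 2) ∨
    wordDist X x y + wordDist X z w ≤ wordDist X x w + wordDist X y z + (6 * δ + 2) := by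
  obtain ⟨γ, hγ⟩ := exists_isGeodesic hgen x y
  obtain ⟨γ₁, h₁⟩ := exists_isGeodesic hgen x z
  obtain ⟨γ₂, h₂⟩ := exists_isGeodesic hgen z y
  obtain ⟨i, hi, hw⟩ := hthin.exists_near hgen w hγ
  have c1 := wordDist_comm hgen w x
  have c2 := wordDist_comm hgen w y
  have c3 := wordDist_comm hgen w z
  have c4 := wordDist_comm hgen z y
  obtain ⟨j, ⟨hj, hd⟩ | ⟨hj, hd⟩⟩ := hthin x z y γ₁ γ₂ γ h₁ h₂ hγ i hi
  · have l := h₁.wordDist_left hj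
    have r := h₁.wordDist_right hj
    have t1 := wordDist_triangle hgen w (γ i) (γ₁ j)
    have t2 := wordDist_triangle hgen w (γ₁ j) x
    have t3 := wordDist_triangle hgen w (γ₁ j) z
    rw [wordDist_comm hgen (γ₁ j) x] at t2
    omega
  · have l := h₂.wordDist_left hj
    have r := h₂.wordDist_right hj
    have t1 := wordDist_triangle hgen w (γ i) (γ₂ j)
    have t2 := wordDist_triangle hgen w (γ₂ j) z
    have t3 := wordDist_triangle hgen w (γ₂ j) y
    rw [wordDist_comm hgen (γ₂ j) z] at t2
    omega

theorem finite_wordLength_le (hgen : Subgroup.closure X = ⊤) (hX : X.Finite) (n : ℕ) :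
    {g : G | wordLength X g ≤ n}.Finite := by
  have hS : (X ∪ X⁻¹).Finite := hX.union hX.inv
  have : Finite (X ∪ X⁻¹ : Set G) := hS
  refine ((List.finite_length_le (X ∪ X⁻¹ : Set G) n).image
    fun v => (v.map Subtype.val).prod).subset fun g hg => ?_
  obtain ⟨w, hw, hwX, rfl⟩ := exists_word hgen g
  lift w to List (X ∪ X⁻¹ : Set G) using hwX
  refine ⟨w, ?_, rfl⟩
  rw [List.length_map] at hw
  exact hw.trans_le hg

end WordLength

/-- A length function on a group satisfying Gromov's four-point condition, all of whose balls are
finite, and for which every element has initial segments of every smaller length. -/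
structure IsHyperbolicLength {G : Type*} [Group G] (L : G → ℕ) (D : ℕ) : Prop where
  map_one : L 1 = 0
  map_inv : ∀ g, L g⁻¹ = L g
  map_mul_le : ∀ g h, L (g * h) ≤ L g + L h
  exists_mul_eq : ∀ g n, n ≤ L g → ∃ p q, p * q = g ∧ L p = n ∧ L p + L q = L g
  finite_ball : ∀ n, {g | L g ≤ n}.Finite
  four_point : ∀ x y z w,
    L (x⁻¹ * y) + L (z⁻¹ * w) ≤ L (x⁻¹ * z) + L (y⁻¹ * w) + D ∨
    L (x⁻¹ * y) + L (z⁻¹ * w) ≤ L (x⁻¹ * w) + L (y⁻¹ * z) + D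

/-- The left-invariant distance attached to a length function, as an integer. -/
def lengthDist {G : Type*} [Group G] (L : G → ℕ) (x y : G) : ℤ := L (x⁻¹ * y)

/-- Twice the Gromov product of `x` and `y` based at the identity. -/
def twiceGromov {G : Type*} [Group G] (L : G → ℕ) (x y : G) : ℤ :=
  lengthDist L 1 x + lengthDist L 1 y - lengthDist L x y

namespace IsHyperbolicLength

open Filter

variable {G : Type*} [Group G] {L : G → ℕ} {D : ℕ}

theorem lengthDist_one (x : G) : lengthDist L 1 x = L x := by simp [lengthDist]

theorem lengthDist_mul_left (g x y : G) :
    lengthDist L (g * x) (g * y) = lengthDist L x y := by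
  simp [lengthDist, mul_assoc]

theorem lengthDist_self_mul (g x : G) : lengthDist L g (g * x) = lengthDist L 1 x := by
  simpa using lengthDist_mul_left (L := L) g 1 x

theorem lengthDist_inv_left (g x : G) : lengthDist L g⁻¹ x = lengthDist L 1 (g * x) := by
  simp [lengthDist]

theorem lengthDist_self (hL : IsHyperbolicLength L D) (x : G) : lengthDist L x x = 0 := by
  simp [lengthDist, hL.map_one]

theorem lengthDist_comm (hL : IsHyperbolicLength L D) (x y : G) :
    lengthDist L x y = lengthDist L y x := by
  have := hL.map_inv (x⁻¹ * y)
  simp only [mul_inv_rev, inv_inv] at this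
  simp [lengthDist, this]

theorem lengthDist_triangle (hL : IsHyperbolicLength L D) (x y z : G) :
    lengthDist L x z ≤ lengthDist L x y + lengthDist L y z := by
  have := hL.map_mul_le (x⁻¹ * y) (y⁻¹ * z)
  simp only [mul_assoc, mul_inv_cancel_left] at this
  simp only [lengthDist]
  exact_mod_cast this

theorem lengthDist_four_point (hL : IsHyperbolicLength L D) (x y z w : G) :
    lengthDist L x y + lengthDist L z w ≤ lengthDist L x z + lengthDist L y w + D ∨
    lengthDist L x y + lengthDist L z w ≤ lengthDist L x w + lengthDist L y z + D := by
  have := hL.four_point x y z w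
  simp only [lengthDist]
  exact_mod_cast this

theorem exists_between (hL : IsHyperbolicLength L D) (g : G) (n : ℕ) (hn : n ≤ L g) :
    ∃ p, L p = n ∧ lengthDist L p g = L g - n := by
  obtain ⟨p, q, rfl, hp, hq⟩ := hL.exists_mul_eq g n hn
  refine ⟨p, hp, ?_⟩
  rw [lengthDist_self_mul, lengthDist_one]
  omega

theorem twiceGromov_mul_mul (hL : IsHyperbolicLength L D) (g x y : G) :
    twiceGromov L x y - 2 * L g ≤ twiceGromov L (g * x) (g * y) := by
  have h1 := hL.lengthDist_triangle g 1 (g * x)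
  have h2 := hL.lengthDist_triangle g 1 (g * y)
  simp only [twiceGromov, lengthDist_mul_left, lengthDist_self_mul, hL.lengthDist_comm g 1,
    lengthDist_one g] at *
  omega

theorem twiceGromov_comm (hL : IsHyperbolicLength L D) (x y : G) :
    twiceGromov L x y = twiceGromov L y x := by
  simp only [twiceGromov, hL.lengthDist_comm x y]
  ring

theorem twiceGromov_le (hL : IsHyperbolicLength L D) (x y z : G) :
    twiceGromov L x y ≤ twiceGromov L x z + D ∨ twiceGromov L y z ≤ twiceGromov L x z + D := by
  have := hL.lengthDist_four_point x z 1 y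
  simp only [twiceGromov, hL.lengthDist_comm z 1, hL.lengthDist_comm x 1,
    hL.lengthDist_comm z y] at *
  omega

theorem twiceGromov_self (hL : IsHyperbolicLength L D) (x : G) :
    twiceGromov L x x = 2 * L x := by
  simp only [twiceGromov, hL.lengthDist_self, lengthDist_one]
  ring

/-- The elements `g` such that `g * h` and `h` converge to the same boundary point as `h` runs
along the ultrafilter `ω`. -/
def boundaryStabilizer (hL : IsHyperbolicLength L D) (ω : Ultrafilter G)
    (hω : Tendsto L ω atTop) : Subgroup G where
  carrier := {g | ∀ n : ℤ, ∀ᶠ h in ω, n ≤ twiceGromov L (g * h) h}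
  one_mem' := fun n => by
    filter_upwards [hω.eventually_ge_atTop n.toNat] with h hh
    rw [one_mul, hL.twiceGromov_self]
    omega
  mul_mem' := fun {x y} hx hy n => by
    filter_upwards [hx (n + D), hy (n + D + 2 * L x)] with h h1 h2
    have h3 := hL.twiceGromov_mul_mul x (y * h) h
    have h4 := hL.twiceGromov_le (x * (y * h)) (x * h) h
    rw [mul_assoc]
    omega
  inv_mem' := fun {x} hx n => by
    filter_upwards [hx (n + 2 * L x)] with h h1
    have h3 := hL.twiceGromov_mul_mul x⁻¹ (x * h) h
    rw [inv_mul_cancel_left, hL.map_inv, hL.twiceGromov_comm h] at h3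
    omega

theorem mem_boundaryStabilizer (hL : IsHyperbolicLength L D) {ω : Ultrafilter G}
    {hω : Tendsto L ω atTop} {g : G} :
    g ∈ hL.boundaryStabilizer ω hω ↔ ∀ n : ℤ, ∀ᶠ h in ω, n ≤ twiceGromov L (g * h) h :=
  Iff.rfl

theorem exists_eventually_sub_eq (hL : IsHyperbolicLength L D) (ω : Ultrafilter G) (g : G) :
    ∃ c : ℤ, ∀ᶠ h in ω, (L (g * h) : ℤ) - L h = c := by
  have : ∀ᶠ h in ω, ∃ c ∈ Set.Icc (-(L g : ℤ)) (L g), (L (g * h) : ℤ) - L h = c := by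
    refine Eventually.of_forall fun h => ⟨_, ?_, rfl⟩
    have h1 := hL.map_mul_le g h
    have h2 := hL.map_mul_le g⁻¹ (g * h)
    rw [inv_mul_cancel_left, hL.map_inv] at h2
    constructor <;> omega
  obtain ⟨c, -, hc⟩ := (Ultrafilter.eventually_exists_mem_iff (Set.finite_Icc _ _)).1 this
  exact ⟨c, hc⟩

/-- The Busemann function of the boundary point determined by the ultrafilter `ω`. -/
noncomputable def busemann (hL : IsHyperbolicLength L D) (ω : Ultrafilter G) (g : G) : ℤ :=
  (hL.exists_eventually_sub_eq ω g).choose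

theorem eventually_busemann (hL : IsHyperbolicLength L D) (ω : Ultrafilter G) (g : G) :
    ∀ᶠ h in ω, lengthDist L 1 (g * h) - lengthDist L 1 h = hL.busemann ω g := by
  simp only [lengthDist_one]
  exact (hL.exists_eventually_sub_eq ω g).choose_spec

theorem busemann_one (hL : IsHyperbolicLength L D) (ω : Ultrafilter G) :
    hL.busemann ω 1 = 0 := by
  obtain ⟨h, hh⟩ := (hL.eventually_busemann ω 1).exists
  rw [← hh, one_mul, sub_self]

theorem abs_busemann_mul_sub_le (hL : IsHyperbolicLength L D) {ω : Ultrafilter G}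
    {hω : Tendsto L ω atTop} (g : G) {k : G} (hk : k ∈ hL.boundaryStabilizer ω hω) :
    |hL.busemann ω (g * k) - hL.busemann ω g - hL.busemann ω k| ≤ D := by
  obtain ⟨h, h1, h2, h3, h4⟩ := ((hL.eventually_busemann ω (g * k)).and
    ((hL.eventually_busemann ω g).and
    ((hL.eventually_busemann ω k).and (hk (2 * L g + D + 1))))).exists
  have f1 := hL.lengthDist_four_point g⁻¹ (k * h) 1 h
  have f2 := hL.lengthDist_four_point g⁻¹ h 1 (k * h)
  have t1 := hL.lengthDist_triangle 1 g⁻¹ (k * h)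
  have t2 := hL.lengthDist_triangle 1 g⁻¹ h
  have e1 : lengthDist L 1 g⁻¹ = L g := by rw [lengthDist_one, hL.map_inv]
  rw [hL.lengthDist_comm g⁻¹ 1, hL.lengthDist_comm (k * h) 1] at f1
  rw [hL.lengthDist_comm g⁻¹ 1, hL.lengthDist_comm h 1, hL.lengthDist_comm h (k * h)] at f2
  simp only [lengthDist_inv_left, twiceGromov, mul_assoc] at *
  rw [abs_le]
  omega

theorem card_le_of_busemann_le (hL : IsHyperbolicLength L D) {ω : Ultrafilter G}
    {hω : Tendsto L ω atTop} (c : ℕ) (F : Finset G)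
    (hF : ∀ g ∈ F, g ∈ hL.boundaryStabilizer ω hω ∧ |hL.busemann ω g| ≤ c) :
    F.card ≤ {g | L g ≤ c + 2 * D}.ncard := by
  obtain ⟨M, hM⟩ : ∃ M, ∀ g ∈ F, L g ≤ M := ⟨F.sup L, fun g hg => Finset.le_sup hg⟩
  set T : ℕ := M + c with hT
  have hev : ∀ᶠ h in ω, ∀ g ∈ F,
      lengthDist L 1 (g * h) - lengthDist L 1 h = hL.busemann ω g ∧
      (2 * T + 2 * c + 2 * D : ℤ) ≤ twiceGromov L (g * h) h := by
    rw [Finset.eventually_all]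
    exact fun g hg => (hL.eventually_busemann ω g).and ((hF g hg).1 _)
  obtain ⟨h, hh, hLh⟩ := (hev.and (hω.eventually_ge_atTop T)).exists
  obtain ⟨p, hp, hph⟩ := hL.exists_between h T hLh
  rw [← lengthDist_one h] at hph
  have hp' : lengthDist L 1 p = T := by rw [lengthDist_one, hp]
  have key : ∀ g ∈ F, L (p⁻¹ * (g * p)) ≤ c + 2 * D := by
    intro g hg
    obtain ⟨h1, h2⟩ := hh g hg
    have hb := abs_le.1 (hF g hg).2
    have hMg := hM g hg
    have hg1 := lengthDist_one (L := L) g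
    have f1 := hL.lengthDist_four_point 1 (g * p) g (g * h)
    have f2 := hL.lengthDist_four_point (g * p) h 1 (g * h)
    have f3 := hL.lengthDist_four_point p (g * p) 1 h
    rw [hL.lengthDist_comm (g * p) g] at f1
    rw [hL.lengthDist_comm (g * p) 1, hL.lengthDist_comm h 1, hL.lengthDist_comm h (g * h)] at f2
    rw [hL.lengthDist_comm (g * p) 1, hL.lengthDist_comm p 1] at f3
    simp only [lengthDist_mul_left, lengthDist_self_mul, twiceGromov] at *
    have goal : lengthDist L p (g * p) ≤ c + 2 * D := by omega
    unfold lengthDist at goal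
    exact_mod_cast goal
  rw [← Set.ncard_coe_finset]
  refine Set.ncard_le_ncard_of_injOn (fun g => p⁻¹ * (g * p)) key ?_ (hL.finite_ball _)
  intro a _ b _ hab
  simpa using hab

theorem finite_busemann_le (hL : IsHyperbolicLength L D) (ω : Ultrafilter G)
    (hω : Tendsto L ω atTop) (c : ℕ) :
    {g | g ∈ hL.boundaryStabilizer ω hω ∧ |hL.busemann ω g| ≤ c}.Finite := by
  by_contra hinf
  obtain ⟨F, hF, hcard⟩ :=
    Set.Infinite.exists_subset_card_eq hinf ({g | L g ≤ c + 2 * D}.ncard + 1)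
  have := hL.card_le_of_busemann_le c F fun g hg => hF hg
  omega

theorem exists_finite_coset_reps (hL : IsHyperbolicLength L D) {ω : Ultrafilter G}
    {hω : Tendsto L ω atTop} (hinf : (hL.boundaryStabilizer ω hω : Set G).Infinite) :
    ∃ t ∈ hL.boundaryStabilizer ω hω, ∃ F : Set G, F.Finite ∧
      ∀ g ∈ hL.boundaryStabilizer ω hω, ∃ z ∈ Subgroup.zpowers t, z * g ∈ F := by
  obtain ⟨t, ht, hbt⟩ : ∃ t ∈ hL.boundaryStabilizer ω hω, D < hL.busemann ω t := by
    by_contra! hcon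
    refine hinf ((hL.finite_busemann_le ω hω (2 * D)).subset fun g hg => ⟨hg, ?_⟩)
    have h1 := hcon g hg
    have h2 := hcon g⁻¹ (inv_mem hg)
    have h3 := abs_le.1 (hL.abs_busemann_mul_sub_le g (inv_mem hg))
    rw [mul_inv_cancel, busemann_one] at h3
    rw [abs_le]
    push_cast
    omega
  set c : ℕ := (hL.busemann ω t + D).toNat with hc
  refine ⟨t, ht, _, hL.finite_busemann_le ω hω c, ?_⟩
  suffices ∀ n : ℕ, ∀ g ∈ hL.boundaryStabilizer ω hω, (hL.busemann ω g).natAbs = n →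
      ∃ z ∈ Subgroup.zpowers t, |hL.busemann ω (z * g)| ≤ c by
    intro g hg
    obtain ⟨z, hz, hzg⟩ := this _ g hg rfl
    exact ⟨z, hz, mul_mem ((Subgroup.zpowers_le.2 ht) hz) hg, hzg⟩
  intro n
  induction n using Nat.strong_induction_on with
  | _ n ih =>
    intro g hg hn
    by_cases hle : |hL.busemann ω g| ≤ c
    · exact ⟨1, one_mem _, by rwa [one_mul]⟩
    have hstep : ∀ s ∈ Subgroup.zpowers t, (hL.busemann ω (s * g)).natAbs < n →
        ∃ z ∈ Subgroup.zpowers t, |hL.busemann ω (z * g)| ≤ c := by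
      intro s hs hlt
      obtain ⟨z, hz, hzg⟩ :=
        ih _ hlt (s * g) (mul_mem ((Subgroup.zpowers_le.2 ht) hs) hg) rfl
      exact ⟨z * s, mul_mem hz hs, by rwa [mul_assoc]⟩
    rw [abs_le] at hle
    have h1 := abs_le.1 (hL.abs_busemann_mul_sub_le t hg)
    have h2 := abs_le.1 (hL.abs_busemann_mul_sub_le t (mul_mem (inv_mem ht) hg))
    rw [mul_inv_cancel_left] at h2
    by_cases hpos : 0 ≤ hL.busemann ω g
    · exact hstep t⁻¹ (inv_mem (Subgroup.mem_zpowers t)) (by omega)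
    · exact hstep t (Subgroup.mem_zpowers t) (by omega)

theorem virtuallyCyclic_of_finiteIndex (hL : IsHyperbolicLength L D) [Infinite G]
    {ω : Ultrafilter G} {hω : Tendsto L ω atTop}
    (hfin : (hL.boundaryStabilizer ω hω).FiniteIndex) : VirtuallyCyclic G := by
  set H := hL.boundaryStabilizer ω hω with hH
  have hinf : (H : Set G).Infinite := by
    intro hf
    have : Finite H := hf
    have := Subgroup.card_mul_index H
    rw [Nat.card_eq_zero_of_infinite (α := G)] at this
    exact (mul_ne_zero Nat.card_pos.ne' hfin.index_ne_zero) this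
  obtain ⟨t, ht, F, hF, hcov⟩ := hL.exists_finite_coset_reps hinf
  refine ⟨Subgroup.zpowers t, inferInstance, ⟨?_⟩⟩
  rw [← Subgroup.relIndex_mul_index ((Subgroup.zpowers_le.2 ht : Subgroup.zpowers t ≤ H))]
  refine mul_ne_zero ?_ hfin.index_ne_zero
  have hF' : ((fun g : H => (g : G)) ⁻¹' F).Finite := hF.preimage Subtype.val_injective.injOn
  have : Finite ((fun g : H => (g : G)) ⁻¹' F) := hF'
  have hsurj : Function.Surjective fun f : ((fun g : H => (g : G)) ⁻¹' F) =>
      (QuotientGroup.mk (f : H)⁻¹ : H ⧸ (Subgroup.zpowers t).subgroupOf H) := by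
    intro q
    induction q using QuotientGroup.induction_on with
    | H x =>
      obtain ⟨z, hz, hzx⟩ := hcov x⁻¹ (inv_mem x.2)
      refine ⟨⟨⟨z * x⁻¹, mul_mem (Subgroup.zpowers_le.2 ht hz) (inv_mem x.2)⟩, hzx⟩, ?_⟩
      rw [QuotientGroup.eq, Subgroup.mem_subgroupOf]
      simpa using hz
  have := Finite.of_surjective _ hsurj
  exact Subgroup.finiteIndex_of_finite_quotient.index_ne_zero

theorem exists_twiceGromov_le (hL : IsHyperbolicLength L D) [Infinite G]
    (hne : ¬ VirtuallyCyclic G) (A : Finset G) (h1 : 1 ∈ A)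
    (hA : Subgroup.closure (A : Set G) = ⊤) :
    ∃ K : ℕ, ∀ h, ∃ x ∈ A, twiceGromov L (x * h) h ≤ K := by
  by_contra! hcon
  choose h hh using hcon
  let ω : Ultrafilter G := (Filter.hyperfilter ℕ).map h
  have hev : ∀ x ∈ A, ∀ n : ℤ, ∀ᶠ k in ω, n ≤ twiceGromov L (x * k) k := by
    intro x hx n
    change ∀ᶠ k in hyperfilter ℕ, n ≤ twiceGromov L (x * h k) (h k)
    have : ∀ᶠ k : ℕ in hyperfilter ℕ, n.toNat ≤ k :=
      Nat.hyperfilter_le_atTop (eventually_ge_atTop _)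
    filter_upwards [this] with k hk
    have := hh k x hx
    omega
  have hω : Tendsto L ω atTop := by
    rw [tendsto_atTop]
    intro n
    filter_upwards [hev 1 h1 (2 * n)] with k hk
    rw [one_mul, hL.twiceGromov_self] at hk
    omega
  have htop : hL.boundaryStabilizer ω hω = ⊤ := by
    rw [eq_top_iff, ← hA, Subgroup.closure_le]
    exact fun x hx => hev x hx
  refine hne (hL.virtuallyCyclic_of_finiteIndex (ω := ω) (hω := hω) ?_)
  rw [htop]
  infer_instance

theorem finite_sphere (hL : IsHyperbolicLength L D) (n : ℕ) : {g | L g = n}.Finite :=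
  (hL.finite_ball n).subset fun _ hg => le_of_eq hg

theorem tendsto_cofinite_atTop (hL : IsHyperbolicLength L D) : Tendsto L cofinite atTop := by
  rw [tendsto_atTop]
  intro n
  rw [eventually_cofinite]
  exact (hL.finite_ball n).subset fun g hg => le_of_not_ge hg

theorem exists_card_lt_ncard_sphere (hL : IsHyperbolicLength L D) [Infinite G]
    (hne : ¬ VirtuallyCyclic G) (M : ℕ) : ∃ n, M < {g | L g = n}.ncard := by
  by_contra! hcon
  let ω : Ultrafilter G := hyperfilter G
  have hω : Tendsto L ω atTop := hL.tendsto_cofinite_atTop.mono_left hyperfilter_le_cofinite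
  refine hne (hL.virtuallyCyclic_of_finiteIndex (ω := ω) (hω := hω) ?_)
  set H := hL.boundaryStabilizer ω hω with hH
  by_contra hfin
  have hinf : Infinite (G ⧸ H) := by
    rw [← not_finite_iff_infinite]
    intro hf
    exact hfin Subgroup.finiteIndex_of_finite_quotient
  let f : Fin (M + 1) → G := fun i => (Infinite.natEmbedding (G ⧸ H) i).out
  have hf : ∀ i j, i ≠ j → (f j)⁻¹ * f i ∉ H := by
    intro i j hij hmem
    rw [← QuotientGroup.eq, QuotientGroup.out_eq', QuotientGroup.out_eq'] at hmem
    exact hij (Fin.ext ((Infinite.natEmbedding (G ⧸ H)).injective hmem)).symm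
  have hb : ∀ i j, ∃ K : ℕ, i ≠ j → ∀ᶠ h in ω, twiceGromov L (f i * h) (f j * h) ≤ K := by
    intro i j
    by_cases hij : i = j
    · exact ⟨0, fun h => absurd hij h⟩
    have := hf i j hij
    rw [hH, hL.mem_boundaryStabilizer] at this
    push Not at this
    obtain ⟨n, hn⟩ := this
    refine ⟨(n + 2 * L (f j)).toNat, fun _ => ?_⟩
    filter_upwards [hn] with h hh
    have := hL.twiceGromov_mul_mul (f j)⁻¹ (f i * h) (f j * h)
    rw [inv_mul_cancel_left, ← mul_assoc, hL.map_inv] at this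
    omega
  choose K hK using hb
  let N : ℕ := (∑ i, ∑ j, K i j) + D + 1
  have hN : ∀ i j, K i j + D < N := fun i j => by
    have h1 : K i j ≤ ∑ j, K i j := Finset.single_le_sum (f := K i) (by simp) (Finset.mem_univ j)
    have h2 : ∑ j, K i j ≤ ∑ i, ∑ j, K i j :=
      Finset.single_le_sum (f := fun i => ∑ j, K i j) (by simp) (Finset.mem_univ i)
    omega
  have hev : ∀ᶠ h in ω, ∀ i j, i ≠ j → twiceGromov L (f i * h) (f j * h) ≤ K i j := by
    simp only [eventually_all]
    exact hK
  have hlen : ∀ᶠ h in ω, ∀ i, N ≤ L (f i * h) := by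
    rw [eventually_all]
    intro i
    filter_upwards [hω.eventually_ge_atTop (N + L (f i))] with h hh
    have h2 := hL.map_mul_le (f i)⁻¹ (f i * h)
    rw [inv_mul_cancel_left, hL.map_inv] at h2
    omega
  obtain ⟨h, hh, hl⟩ := (hev.and hlen).exists
  choose p hp hph using fun i => hL.exists_between (f i * h) N (hl i)
  have hpg : ∀ i, twiceGromov L (p i) (f i * h) = 2 * N := fun i => by
    simp only [twiceGromov, hph, lengthDist_one, hp]
    ring
  have hinj : Function.Injective p := by
    intro i j hij
    by_contra hne'
    have h1 := hL.twiceGromov_le (f i * h) (p i) (f j * h)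
    have h2 := hh i j hne'
    have h3 := hN i j
    rw [hL.twiceGromov_comm _ (p i), hpg, hij, hpg] at h1
    omega
  have hsub : Set.range p ⊆ {g | L g = N} := by
    rintro _ ⟨i, rfl⟩
    exact hp i
  have h1 := Set.ncard_le_ncard hsub (hL.finite_sphere N)
  have h2 := hcon N
  rw [← Set.image_univ, Set.ncard_image_of_injective _ hinj, Set.ncard_univ, Nat.card_fin] at h1
  omega

theorem one_le_ncard_sphere (hL : IsHyperbolicLength L D) [Infinite G] (n : ℕ) :
    1 ≤ {g | L g = n}.ncard := by
  obtain ⟨g, hg⟩ := (hL.tendsto_cofinite_atTop.eventually_ge_atTop n).exists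
  obtain ⟨p, hp, -⟩ := hL.exists_between g n hg
  exact (Set.ncard_pos (hL.finite_sphere n)).2 ⟨p, hp⟩

theorem ncard_sphere_add_le (hL : IsHyperbolicLength L D) (m n : ℕ) :
    {g | L g = m + n}.ncard ≤ {g | L g = m}.ncard * {g | L g = n}.ncard := by
  rw [← Set.ncard_prod]
  have hsub : {g | L g = m + n} ⊆
      (fun q : G × G => q.1 * q.2) '' ({g | L g = m} ×ˢ {g | L g = n}) := by
    intro g hg
    have hg : L g = m + n := hg
    obtain ⟨p, q, hpq, hp, hq⟩ := hL.exists_mul_eq g m (by omega)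
    exact ⟨(p, q), ⟨hp, show L q = n by omega⟩, hpq⟩
  have hfin := (hL.finite_sphere m).prod (hL.finite_sphere n)
  exact (Set.ncard_le_ncard hsub (hfin.image _)).trans (Set.ncard_image_le hfin)

theorem ncard_le_of_lengthDist_le (hL : IsHyperbolicLength L D) (r : ℕ) (F : Finset G)
    (hF : ∀ g ∈ F, ∀ h ∈ F, lengthDist L g h ≤ r) : F.card ≤ {g | L g ≤ r}.ncard := by
  obtain rfl | ⟨g, hg⟩ := F.eq_empty_or_nonempty
  · simp
  rw [← Set.ncard_coe_finset]
  refine Set.ncard_le_ncard_of_injOn (fun x => g⁻¹ * x) (fun x hx => ?_)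
    (mul_right_injective _).injOn (hL.finite_ball r)
  have := hF g hg x hx
  unfold lengthDist at this
  exact_mod_cast this

theorem exists_ncard_sphere_mul_le (hL : IsHyperbolicLength L D) [Infinite G]
    (hne : ¬ VirtuallyCyclic G) (A : Finset G) (h1 : 1 ∈ A)
    (hA : Subgroup.closure (A : Set G) = ⊤) :
    ∃ K Q : ℕ, 1 ≤ Q ∧ ∀ m n, K ≤ m → K ≤ n →
      {g | L g = m}.ncard * {g | L g = n}.ncard ≤ Q * {g | L g = m + n - K}.ncard := by
  obtain ⟨K₀, hK₀⟩ := hL.exists_twiceGromov_le hne A h1 hA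
  obtain ⟨a, ha⟩ : ∃ a, ∀ x ∈ A, L x ≤ a := ⟨A.sup L, fun g hg => Finset.le_sup hg⟩
  set K : ℕ := K₀ + D + a with hK
  have hglue : ∀ g h, ∃ x ∈ A, twiceGromov L g⁻¹ (x * h) ≤ K₀ + D := by
    intro g h
    obtain ⟨x, hx, hxh⟩ := hK₀ h
    have := hL.twiceGromov_le (x * h) g⁻¹ h
    rw [hL.twiceGromov_comm (x * h)] at this
    rcases this with h3 | h3
    · exact ⟨x, hx, by omega⟩
    · exact ⟨1, h1, by rw [one_mul]; omega⟩
  choose x hx hgx using hglue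
  have hlow : ∀ g h, (L g + L h : ℤ) - K ≤ L (g * (x g h * h)) := by
    intro g h
    have e1 := hgx g h
    have e2 := hL.map_mul_le (x g h)⁻¹ (x g h * h)
    have e3 := ha _ (hx g h)
    rw [inv_mul_cancel_left, hL.map_inv] at e2
    simp only [twiceGromov, lengthDist_inv_left, lengthDist_one, hL.map_inv] at e1
    omega
  have hlen : ∀ g h, L (x g h * h) ≤ a + L h := fun g h =>
    (hL.map_mul_le _ _).trans (Nat.add_le_add_right (ha _ (hx g h)) _)
  have hone : 1 ∈ {g | L g ≤ 2 * K} := by simp [hL.map_one]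
  have hpos : 1 ≤ {g | L g ≤ 2 * K}.ncard :=
    (Set.ncard_pos (hL.finite_ball _)).2 ⟨1, hone⟩
  have hApos : 1 ≤ A.card := Finset.card_pos.2 ⟨1, h1⟩
  refine ⟨K, {g | L g ≤ 2 * K}.ncard * ({g | L g ≤ 2 * K}.ncard * A.card),
    Nat.mul_pos hpos (Nat.mul_pos hpos hApos), fun m n hm hn => ?_⟩
  classical
  have hsplit : ∀ y : G × G, ∃ r : G × G, L y.1 = m → L y.2 = n →
      r.1 * r.2 = y.1 * (x y.1 y.2 * y.2) ∧ L r.1 = m + n - K ∧ L r.2 ≤ 2 * K := by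
    intro y
    by_cases hy : L y.1 = m ∧ L y.2 = n
    · have e1 := hlow y.1 y.2
      have e2 := hlen y.1 y.2
      have e3 := hL.map_mul_le y.1 (x y.1 y.2 * y.2)
      obtain ⟨p, q, hpq, hp, hq⟩ :=
        hL.exists_mul_eq (y.1 * (x y.1 y.2 * y.2)) (m + n - K) (by omega)
      exact ⟨(p, q), fun _ _ => ⟨hpq, hp, by dsimp only; omega⟩⟩
    · exact ⟨1, fun h h' => absurd ⟨h, h'⟩ hy⟩
  choose r hr using hsplit
  set S := (hL.finite_sphere m).toFinset ×ˢ (hL.finite_sphere n).toFinset with hS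
  set T := (hL.finite_sphere (m + n - K)).toFinset ×ˢ
    ((hL.finite_ball (2 * K)).toFinset ×ˢ A) with hT
  have hmaps : ∀ y ∈ S, ((r y).1, (r y).2, x y.1 y.2) ∈ T := by
    intro y hy
    simp only [hS, Finset.mem_product, Set.Finite.mem_toFinset, Set.mem_ofPred_eq] at hy
    obtain ⟨-, e1, e2⟩ := hr y hy.1 hy.2
    simp only [hT, Finset.mem_product, Set.Finite.mem_toFinset, Set.mem_ofPred_eq]
    exact ⟨e1, e2, hx _ _⟩
  have hcard := Finset.card_le_mul_card_image_of_maps_to hmaps {g | L g ≤ 2 * K}.ncard ?_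
  · simp only [hS, hT, Finset.card_product, ← Set.ncard_eq_toFinset_card] at hcard
    calc _ ≤ _ := hcard
      _ = _ := by ring
  rintro ⟨p, q, z⟩ -
  set F := S.filter fun y => ((r y).1, (r y).2, x y.1 y.2) = (p, q, z) with hF
  have hmem : ∀ y ∈ F, L y.1 = m ∧ L y.2 = n ∧ x y.1 y.2 = z ∧ y.1 * (z * y.2) = p * q := by
    intro y hy
    simp only [hF, hS, Finset.mem_filter, Finset.mem_product, Set.Finite.mem_toFinset,
      Set.mem_ofPred_eq, Prod.mk.injEq] at hy
    obtain ⟨⟨e1, e2⟩, e3, e4, e5⟩ := hy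
    have := (hr y e1 e2).1
    rw [e3, e4, e5] at this
    exact ⟨e1, e2, e5, this.symm⟩
  have hinj : Set.InjOn Prod.fst (F : Set (G × G)) := by
    rintro ⟨g, h⟩ hy ⟨g', h'⟩ hy' (rfl : g = g')
    have e := (hmem _ hy).2.2.2.trans (hmem _ hy').2.2.2.symm
    simpa using e
  rw [← Finset.card_image_of_injOn hinj]
  refine hL.ncard_le_of_lengthDist_le _ _ ?_
  simp only [Finset.mem_image]
  rintro _ ⟨y, hy, rfl⟩ _ ⟨y', hy', rfl⟩
  obtain ⟨a1, a2, a3, a4⟩ := hmem y hy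
  obtain ⟨b1, b2, b3, b4⟩ := hmem y' hy'
  have e1 := hlow y.1 y.2
  have e2 := hlen y.1 y.2
  have e3 := hlen y'.1 y'.2
  have f := hL.lengthDist_four_point y.1 y'.1 1 (p * q)
  have d1 : lengthDist L y.1 (p * q) = L (z * y.2) := by
    rw [← a4, lengthDist_self_mul, lengthDist_one]
  have d2 : lengthDist L y'.1 (p * q) = L (z * y'.2) := by
    rw [← b4, lengthDist_self_mul, lengthDist_one]
  rw [a3, a4] at e1
  rw [a3] at e2
  rw [b3] at e3
  rw [d1, d2, hL.lengthDist_comm y.1 1, hL.lengthDist_comm y'.1 1] at f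
  simp only [lengthDist_one] at f
  push_cast
  omega

end IsHyperbolicLength

/-- A positive sequence that is submultiplicative, and supermultiplicative up to a multiplicative
constant and a shift, is either bounded or purely exponential. -/
theorem exists_exponential_bounds {a : ℕ → ℝ} (hone : ∀ n, 1 ≤ a n)
    (hsub : ∀ m n, a (m + n) ≤ a m * a n) (K : ℕ) {Q : ℝ} (hQ : 1 ≤ Q)
    (hsuper : ∀ m n, K ≤ m → K ≤ n → a m * a n ≤ Q * a (m + n - K))
    (hunb : ∀ M : ℕ, ∃ n, (M : ℝ) < a n) :
    ∃ lam C D : ℝ, 1 < lam ∧ 0 < C ∧ 0 < D ∧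
      ∀ n : ℕ, 1 ≤ n → C * lam ^ n ≤ a n ∧ a n ≤ D * lam ^ n := by
  have hpos : ∀ n, 0 < a n := fun n => one_pos.trans_le (hone n)
  have hQ0 : 0 < Q := one_pos.trans_le hQ
  have hlog : ∀ n, 0 ≤ Real.log (a n) := fun n => Real.log_nonneg (hone n)
  have hu : Subadditive fun n => Real.log (a n) := fun m n => by
    rw [← Real.log_mul (hpos m).ne' (hpos n).ne']
    exact Real.log_le_log (hpos _) (hsub m n)
  have hubdd : BddBelow (Set.range fun n : ℕ => Real.log (a n) / n) :=
    ⟨0, by rintro _ ⟨n, rfl⟩; exact div_nonneg (hlog n) n.cast_nonneg⟩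
  set l := hu.lim
  have hlow : ∀ n : ℕ, 1 ≤ n → n * l ≤ Real.log (a n) := fun n hn => by
    have hn' : (0 : ℝ) < n := by exact_mod_cast hn
    have := hu.lim_le_div hubdd (n := n) (by omega)
    rw [le_div_iff₀ hn'] at this
    linarith
  have hv : Subadditive fun n => Real.log Q - Real.log (a (n + K)) := fun m n => by
    have h := hsuper (m + K) (n + K) (by omega) (by omega)
    rw [show m + K + (n + K) - K = m + n + K by omega] at h
    have := Real.log_le_log (mul_pos (hpos _) (hpos _)) h
    rw [Real.log_mul (hpos _).ne' (hpos _).ne', Real.log_mul hQ0.ne' (hpos _).ne'] at this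
    linarith
  have hvlim : Filter.Tendsto (fun n : ℕ => (Real.log Q - Real.log (a (n + K))) / n)
      Filter.atTop (nhds (-l)) := by
    have h1 := (hu.tendsto_lim hubdd).comp (Filter.tendsto_add_atTop_nat K)
    have h2 : Filter.Tendsto (fun n : ℕ => 1 + (K : ℝ) / n) Filter.atTop (nhds (1 + 0)) :=
      tendsto_const_nhds.add (tendsto_const_div_atTop_nhds_zero_nat _)
    have h3 := (tendsto_const_div_atTop_nhds_zero_nat (Real.log Q)).sub (h1.mul h2)
    rw [add_zero, mul_one, zero_sub] at h3
    refine h3.congr' ?_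
    filter_upwards [Filter.eventually_ge_atTop 1] with n hn
    have hn' : (0 : ℝ) < n := by exact_mod_cast hn
    have hnK : (0 : ℝ) < n + K := by positivity
    simp only [Function.comp]
    push_cast
    field_simp
  have hvbdd : BddBelow (Set.range fun n : ℕ => (Real.log Q - Real.log (a (n + K))) / n) :=
    hvlim.bddBelow_range
  have hup : ∀ n : ℕ, 1 ≤ n → Real.log (a (n + K)) ≤ Real.log Q + n * l := fun n hn => by
    have hn' : (0 : ℝ) < n := by exact_mod_cast hn
    have h1 := hv.lim_le_div hvbdd (n := n) (by omega)
    rw [tendsto_nhds_unique (hv.tendsto_lim hvbdd) hvlim, le_div_iff₀ hn'] at h1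
    linarith
  have hl0 : 0 < l := by
    obtain ⟨M, hM⟩ := exists_nat_gt (Q + ∑ j ∈ Finset.range (K + 1), a j)
    obtain ⟨n, hn⟩ := hunb M
    have hS : 0 ≤ ∑ j ∈ Finset.range (K + 1), a j :=
      Finset.sum_nonneg fun j _ => (hpos j).le
    have hnK : K < n := by
      by_contra hle
      have := Finset.single_le_sum (f := a) (fun j _ => (hpos j).le)
        (Finset.mem_range.2 (by omega : n < K + 1))
      linarith
    have h1 := hup (n - K) (by omega)
    rw [Nat.sub_add_cancel hnK.le] at h1
    have h2 : Real.log Q < Real.log (a n) := Real.log_lt_log hQ0 (by linarith)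
    by_contra hle
    have : ((n - K : ℕ) : ℝ) * l ≤ 0 :=
      mul_nonpos_of_nonneg_of_nonpos (Nat.cast_nonneg _) (not_lt.1 hle)
    linarith
  have hexp : ∀ n : ℕ, Real.exp l ^ n = Real.exp (n * l) := fun n => (Real.exp_nat_mul l n).symm
  have hS : 0 ≤ ∑ j ∈ Finset.range (K + 1), a j := Finset.sum_nonneg fun j _ => (hpos j).le
  refine ⟨Real.exp l, 1, Q + ∑ j ∈ Finset.range (K + 1), a j, Real.one_lt_exp_iff.2 hl0, one_pos,
    by linarith, fun n hn => ⟨?_, ?_⟩⟩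
  · rw [one_mul, hexp, ← Real.le_log_iff_exp_le (hpos n)]
    exact hlow n hn
  by_cases hnK : n ≤ K
  · have h1 := Finset.single_le_sum (f := a) (fun j _ => (hpos j).le)
      (Finset.mem_range.2 (by omega : n < K + 1))
    have h2 : 1 ≤ Real.exp l ^ n := one_le_pow₀ (Real.one_le_exp hl0.le)
    nlinarith
  · have h1 := hup (n - K) (by omega)
    rw [Nat.sub_add_cancel (by omega)] at h1
    have h2 : ((n - K : ℕ) : ℝ) * l ≤ n * l :=
      mul_le_mul_of_nonneg_right (by exact_mod_cast Nat.sub_le n K) hl0.le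
    have h3 : a n ≤ Q * Real.exp l ^ n := by
      rw [hexp, ← Real.exp_log (hpos n), ← Real.exp_log hQ0, ← Real.exp_add, Real.exp_le_exp]
      linarith
    refine h3.trans (mul_le_mul_of_nonneg_right (by linarith) (by positivity))

theorem TrianglesThin.isHyperbolicLength {G : Type*} [Group G] {X : Set G} {δ : ℕ}
    (hthin : TrianglesThin X δ) (hgen : Subgroup.closure X = ⊤) (hX : X.Finite) :
    IsHyperbolicLength (wordLength X) (6 * δ + 2) where
  map_one := wordLength_one
  map_inv := wordLength_inv hgen
  map_mul_le := wordLength_mul_le hgen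
  exists_mul_eq g n hn := by
    obtain ⟨γ, hγ⟩ := exists_isGeodesic hgen 1 g
    have hg : wordDist X 1 g = wordLength X g := by simp [wordDist]
    have hn' : n ≤ wordDist X 1 g := hg ▸ hn
    have l := hγ.wordDist_left hn'
    have r := hγ.wordDist_right hn'
    refine ⟨γ n, (γ n)⁻¹ * g, mul_inv_cancel_left _ _, by simpa [wordDist] using l, ?_⟩
    simp only [wordDist, inv_one, one_mul] at l r
    omega
  finite_ball := finite_wordLength_le hgen hX
  four_point := hthin.four_point hgen

/-- Let `G` be a non-elementary word-hyperbolic group with a finite generating set `X`.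
Then there are constants `λ > 1` and `C, D > 0` such that `C λ^n ≤ 𝔖(n) ≤ D λ^n` for all
`n ≥ 1` (equivalently, the polynomial exponent in the sphere-growth asymptotics is `0`). -/
theorem coornaert_sphere_growth {G : Type*} [Group G] (X : Finset G)
    (hgen : Subgroup.closure (X : Set G) = ⊤)
    (hhyp : ∃ δ : ℕ, 1 ≤ δ ∧ TrianglesThin (X : Set G) δ)
    (hinf : Infinite G) (hne : ¬ VirtuallyCyclic G) :
    ∃ lam C D : ℝ, 1 < lam ∧ 0 < C ∧ 0 < D ∧
      ∀ n : ℕ, 1 ≤ n →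
        C * lam ^ n ≤ (sphereCard (X : Set G) n : ℝ) ∧
        (sphereCard (X : Set G) n : ℝ) ≤ D * lam ^ n := by
  obtain ⟨δ, -, hthin⟩ := hhyp
  classical
  have hL := hthin.isHyperbolicLength hgen X.finite_toSet
  have hA : Subgroup.closure ((insert 1 X : Finset G) : Set G) = ⊤ := by
    rw [Finset.coe_insert, Subgroup.closure_insert_one, hgen]
  obtain ⟨K, Q, hQ, hsuper⟩ :=
    hL.exists_ncard_sphere_mul_le hne (insert 1 X) (Finset.mem_insert_self _ _) hA
  refine exists_exponential_bounds (a := fun n => (sphereCard (X : Set G) n : ℝ))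
    (fun n => ?_) (fun m n => ?_) K (Q := Q) (by exact_mod_cast hQ) (fun m n hm hn => ?_)
    (fun M => ?_)
  · exact_mod_cast hL.one_le_ncard_sphere n
  · exact_mod_cast hL.ncard_sphere_add_le m n
  · exact_mod_cast hsuper m n hm hn
  · obtain ⟨n, hn⟩ := hL.exists_card_lt_ncard_sphere hne M
    exact ⟨n, by exact_mod_cast hn⟩
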